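/- arXiv:math/9408216 — 4 statements merged into one kernel-verified Lean document; each statement's English description precedes it below -/
import Mathlib

section
/- A twice differentiable function p : ℝ → ℝ is sub-sine if and only if p''(x) + p(x) ≥ 0 for all x ∈ ℝ. -/
open Real

def SubSine (g : ℝ → ℝ) : Prop :=
  ∀ x₁ x₂ : ℝ, x₁ < x₂ → x₂ < x₁ + π →
    ∀ A B : ℝ, A * Real.cos x₁ + B * Real.sin x₁ = g x₁ →
      A * Real.cos x₂ + B * Real.sin x₂ = g x₂ →
      ∀ x ∈ Set.Icc x₁ x₂, g x ≤ A * Real.cos x + B * Real.sin x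

/-- The Wronskian of `q` with `sin (· - c)` has derivative `(q'' + q) * sin (· - c)`. -/
lemma hasDerivAt_wronskian_sin {q q' q'' : ℝ → ℝ}
    (hq : ∀ x, HasDerivAt q (q' x) x) (hq' : ∀ x, HasDerivAt q' (q'' x) x) (c x : ℝ) :
    HasDerivAt (fun t => q' t * sin (t - c) - q t * cos (t - c))
      ((q'' x + q x) * sin (x - c)) x := by
  have hs : HasDerivAt (fun t => sin (t - c)) (cos (x - c)) x := by
    simpa using ((hasDerivAt_id x).sub_const c).sin
  have hc : HasDerivAt (fun t => cos (t - c)) (-sin (x - c)) x := by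
    simpa using ((hasDerivAt_id x).sub_const c).cos
  exact (((hq' x).mul hs).sub ((hq x).mul hc)).congr_deriv (by ring)

/-- A solution of `q'' + q ≥ 0` vanishing at both ends of an interval shorter than `π` is
nonpositive on that interval. -/
lemma nonpos_of_deriv2_add_self_nonneg {q q' q'' : ℝ → ℝ}
    (hq : ∀ x, HasDerivAt q (q' x) x) (hq' : ∀ x, HasDerivAt q' (q'' x) x)
    (hnn : ∀ x, 0 ≤ q'' x + q x) {x₁ x₂ : ℝ} (hlt : x₁ < x₂) (hπ : x₂ < x₁ + π)
    (h₁ : q x₁ = 0) (h₂ : q x₂ = 0) {x : ℝ} (hx : x ∈ Set.Icc x₁ x₂) : q x ≤ 0 := by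
  have hW := hasDerivAt_wronskian_sin hq hq'
  have hmono : MonotoneOn (fun t => q' t * sin (t - x₁) - q t * cos (t - x₁))
      (Set.Icc x₁ x₂) := by
    refine monotoneOn_of_hasDerivWithinAt_nonneg (convex_Icc _ _)
      (fun t _ => (hW x₁ t).continuousAt.continuousWithinAt)
      (fun t _ => (hW x₁ t).hasDerivWithinAt) fun t ht => ?_
    rw [interior_Icc] at ht
    exact mul_nonneg (hnn t) (sin_nonneg_of_nonneg_of_le_pi (by linarith [ht.1])
      (by linarith [ht.2]))
  have hanti : AntitoneOn (fun t => q' t * sin (t - x₂) - q t * cos (t - x₂))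
      (Set.Icc x₁ x₂) := by
    refine antitoneOn_of_hasDerivWithinAt_nonpos (convex_Icc _ _)
      (fun t _ => (hW x₂ t).continuousAt.continuousWithinAt)
      (fun t _ => (hW x₂ t).hasDerivWithinAt) fun t ht => ?_
    rw [interior_Icc] at ht
    exact mul_nonpos_of_nonneg_of_nonpos (hnn t)
      (sin_nonpos_of_nonpos_of_neg_pi_le (by linarith [ht.2]) (by linarith [ht.1]))
  have hleft := hmono (Set.left_mem_Icc.2 hlt.le) hx hx.1
  have hright := hanti hx (Set.right_mem_Icc.2 hlt.le) hx.2
  simp only [h₁, h₂, sub_self, sin_zero, mul_zero, zero_mul] at hleft hright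
  have hs₁ : 0 ≤ sin (x - x₁) :=
    sin_nonneg_of_nonneg_of_le_pi (by linarith [hx.1]) (by linarith [hx.2])
  have hs₂ : sin (x - x₂) ≤ 0 :=
    sin_nonpos_of_nonpos_of_neg_pi_le (by linarith [hx.2]) (by linarith [hx.1])
  have hs : 0 < sin (x₂ - x₁) := sin_pos_of_pos_of_lt_pi (by linarith) (by linarith)
  have hsum : sin (x₂ - x₁) = sin (x - x₁) * cos (x - x₂) - cos (x - x₁) * sin (x - x₂) := by
    rw [← sin_sub]; ring_nf
  have hle : q x * sin (x₂ - x₁) ≤ 0 := by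
    rw [hsum]
    linarith [mul_nonneg hs₁ hright, mul_nonneg hleft (neg_nonneg.2 hs₂)]
  exact nonpos_of_mul_nonpos_left hle hs

lemma SubSine.two_mul_cos_mul_le {g : ℝ → ℝ} (hg : SubSine g) (a : ℝ) {h : ℝ}
    (h0 : 0 < h) (hπ : h < π / 2) : 2 * cos h * g a ≤ g (a + h) + g (a - h) := by
  have hs : sin h ≠ 0 := (sin_pos_of_pos_of_lt_pi h0 (by linarith)).ne'
  have hc : 0 < cos h := cos_pos_of_mem_Ioo ⟨by linarith, hπ⟩
  have hle := hg (a - h) (a + h) (by linarith) (by linarith)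
    ((g (a - h) * sin (a + h) - g (a + h) * sin (a - h)) / (2 * sin h * cos h))
    ((g (a + h) * cos (a - h) - g (a - h) * cos (a + h)) / (2 * sin h * cos h))
    (by
      field_simp
      simp only [sin_add, sin_sub, cos_add, cos_sub]
      linear_combination 2 * g (a - h) * sin h * cos h * sin_sq_add_cos_sq a)
    (by
      field_simp
      simp only [sin_add, sin_sub, cos_add, cos_sub]
      linear_combination 2 * g (a + h) * sin h * cos h * sin_sq_add_cos_sq a)
    a ⟨by linarith, by linarith⟩
  have heq : (g (a - h) * sin (a + h) - g (a + h) * sin (a - h)) / (2 * sin h * cos h) * cos a +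
      (g (a + h) * cos (a - h) - g (a - h) * cos (a + h)) / (2 * sin h * cos h) * sin a =
      (g (a + h) + g (a - h)) / (2 * cos h) := by
    field_simp
    simp only [sin_add, sin_sub, cos_add, cos_sub]
    linear_combination (g (a + h) + g (a - h)) * sin h * sin_sq_add_cos_sq a
  rw [heq, le_div_iff₀ (by positivity)] at hle
  linarith

theorem stmt7 (p p' p'' : ℝ → ℝ)
    (hd1 : ∀ x : ℝ, HasDerivAt p (p' x) x)
    (hd2 : ∀ x : ℝ, HasDerivAt p' (p'' x) x) :
    SubSine p ↔ ∀ x : ℝ, 0 ≤ p'' x + p x := by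
  constructor
  · intro hp a
    by_contra! hneg
    set φ : ℝ → ℝ := fun h => p (a + h) + p (a - h) - 2 * cos h * p a with hφ
    have hd : ∀ h, HasDerivAt φ (p' (a + h) - p' (a - h) + 2 * sin h * p a) h := fun h =>
      ((((hd1 (a + h)).comp_const_add a h).add ((hd1 (a - h)).comp_const_sub a h)).sub
        (((hasDerivAt_cos h).const_mul 2).mul_const (p a))).congr_deriv (by ring)
    have hderiv : deriv φ = fun h => p' (a + h) - p' (a - h) + 2 * sin h * p a :=
      funext fun h => (hd h).deriv
    have hdd : deriv (deriv φ) 0 = 2 * (p'' a + p a) := by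
      rw [hderiv]
      refine HasDerivAt.deriv ?_
      refine ((((hd2 (a + 0)).comp_const_add a 0).sub ((hd2 (a - 0)).comp_const_sub a 0)).add
        (((hasDerivAt_sin 0).const_mul 2).mul_const (p a))).congr_deriv ?_
      simp only [add_zero, sub_zero, cos_zero]
      ring
    have hφ0 : φ 0 = 0 := by simp only [hφ, add_zero, sub_zero, cos_zero]; ring
    have hmax : IsLocalMax φ 0 := isLocalMax_of_deriv_deriv_neg (by rw [hdd]; linarith)
      (by simp [hderiv]) (hd 0).continuousAt
    have hnn : ∀ h ∈ Set.Ioo (-(π / 2)) (π / 2), 0 ≤ φ h := by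
      intro h hh
      rcases lt_trichotomy h 0 with hlt | rfl | hgt
      · have := hp.two_mul_cos_mul_le a (neg_pos.2 hlt) (by linarith [hh.1])
        rw [cos_neg, sub_neg_eq_add, ← sub_eq_add_neg] at this
        simp only [hφ]
        linarith
      · exact hφ0.ge
      · have := hp.two_mul_cos_mul_le a hgt hh.2
        simp only [hφ]
        linarith
    have hzero : φ =ᶠ[nhds 0] fun _ => 0 := by
      filter_upwards [hmax, Ioo_mem_nhds (neg_lt_zero.2 pi_div_two_pos) pi_div_two_pos]
        with h hle hh
      exact le_antisymm (hφ0 ▸ hle) (hnn h hh)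
    have := hzero.deriv.deriv_eq
    simp only [hdd, deriv_const'] at this
    linarith
  · intro hnn x₁ x₂ hlt hπ A B h₁ h₂ x hx
    have hq : ∀ t, HasDerivAt (fun t => p t - (A * cos t + B * sin t))
        (p' t - (B * cos t - A * sin t)) t := fun t =>
      ((hd1 t).sub (((hasDerivAt_cos t).const_mul A).add
        ((hasDerivAt_sin t).const_mul B))).congr_deriv (by ring)
    have hq' : ∀ t, HasDerivAt (fun t => p' t - (B * cos t - A * sin t))
        (p'' t + (A * cos t + B * sin t)) t := fun t =>
      ((hd2 t).sub (((hasDerivAt_cos t).const_mul B).sub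
        ((hasDerivAt_sin t).const_mul A))).congr_deriv (by ring)
    have := nonpos_of_deriv2_add_self_nonneg hq hq' (fun t => by linarith [hnn t]) hlt hπ
      (by simp only [h₁, sub_self]) (by simp only [h₂, sub_self]) hx
    linarith
end

section
/- A continuous 2π-periodic function p : ℝ → ℝ is the height (support) function of some convex closed curve in the plane, i.e., there exists a nonempty compact convex set K ⊂ ℝ² with p(θ) = sup{⟨z, (cos θ, sin θ)⟩ : z ∈ K} for all θ, if and only if p is sub-sine. -/
open Real

/-- Three-point interpolation identity for sinusoids. -/
theorem sinusoid_interpolation (A B x₁ x₂ x : ℝ) :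
    (A * cos x + B * sin x) * sin (x₂ - x₁) =
      sin (x₂ - x) * (A * cos x₁ + B * sin x₁) + sin (x - x₁) * (A * cos x₂ + B * sin x₂) := by
  simp only [sin_sub]
  ring

/-- The sub-sine property as a three-point inequality. -/
theorem subSine_iff_mul_sin_le (g : ℝ → ℝ) :
    SubSine g ↔ ∀ x₁ x₂ : ℝ, x₁ < x₂ → x₂ < x₁ + π → ∀ x ∈ Set.Icc x₁ x₂,
      g x * sin (x₂ - x₁) ≤ sin (x₂ - x) * g x₁ + sin (x - x₁) * g x₂ := by
  constructor
  · intro h x₁ x₂ h₁ h₂ x hx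
    have hs : 0 < sin (x₂ - x₁) := sin_pos_of_pos_of_lt_pi (by linarith) (by linarith)
    have hA : (g x₁ * sin x₂ - g x₂ * sin x₁) / sin (x₂ - x₁) * cos x₁ +
        (g x₂ * cos x₁ - g x₁ * cos x₂) / sin (x₂ - x₁) * sin x₁ = g x₁ := by
      field_simp
      rw [sin_sub]
      ring
    have hB : (g x₁ * sin x₂ - g x₂ * sin x₁) / sin (x₂ - x₁) * cos x₂ +
        (g x₂ * cos x₁ - g x₁ * cos x₂) / sin (x₂ - x₁) * sin x₂ = g x₂ := by
      field_simp
      rw [sin_sub]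
      ring
    have hle := mul_le_mul_of_nonneg_right (h x₁ x₂ h₁ h₂ _ _ hA hB x hx) hs.le
    rwa [sinusoid_interpolation, hA, hB] at hle
  · intro h x₁ x₂ h₁ h₂ A B hA hB x hx
    have hs : 0 < sin (x₂ - x₁) := sin_pos_of_pos_of_lt_pi (by linarith) (by linarith)
    refine le_of_mul_le_mul_right ?_ hs
    rw [sinusoid_interpolation, hA, hB]
    exact h x₁ x₂ h₁ h₂ x hx

/-- The support function of a nonempty compact planar set is sub-sine. -/
theorem subSine_of_eq_sSup {p : ℝ → ℝ} {K : Set (ℝ × ℝ)} (hne : K.Nonempty) (hK : IsCompact K)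
    (hp : ∀ θ : ℝ, p θ = sSup ((fun z : ℝ × ℝ => z.1 * cos θ + z.2 * sin θ) '' K)) :
    SubSine p := by
  have hle : ∀ θ, ∀ z ∈ K, z.1 * cos θ + z.2 * sin θ ≤ p θ := fun θ z hz => by
    rw [hp θ]
    exact le_csSup (hK.image (by fun_prop)).bddAbove ⟨z, hz, rfl⟩
  intro x₁ x₂ h₁ h₂ A B hA hB x hx
  have hs : 0 < sin (x₂ - x₁) := sin_pos_of_pos_of_lt_pi (by linarith) (by linarith)
  rw [hp x]
  refine csSup_le (hne.image _) ?_
  rintro _ ⟨z, hz, rfl⟩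
  refine le_of_mul_le_mul_right ?_ hs
  simp only [sinusoid_interpolation _ _ x₁ x₂ x]
  rw [hA, hB]
  have hs₁ : 0 ≤ sin (x₂ - x) :=
    sin_nonneg_of_nonneg_of_le_pi (by linarith [hx.2]) (by linarith [hx.1])
  have hs₂ : 0 ≤ sin (x - x₁) :=
    sin_nonneg_of_nonneg_of_le_pi (by linarith [hx.1]) (by linarith [hx.2])
  gcongr
  · exact hle _ z hz
  · exact hle _ z hz

theorem SubSine.add_pi_nonneg {p : ℝ → ℝ} (h : SubSine p) (hcont : Continuous p) (x : ℝ) :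
    0 ≤ p x + p (x + π) := by
  rw [subSine_iff_mul_sin_le] at h
  have hev : ∀ y ∈ Set.Ioo (x + π / 2) (x + π),
      p (x + π / 2) * sin (y - x) ≤ sin (y - (x + π / 2)) * p x + sin (x + π / 2 - x) * p y :=
    fun y hy => h x y (by linarith [hy.1, pi_pos]) hy.2 _ ⟨by linarith [pi_pos], hy.1.le⟩
  have hmem : x + π ∈ closure (Set.Ioo (x + π / 2) (x + π)) := by
    rw [closure_Ioo (by linarith [pi_pos])]
    exact ⟨by linarith [pi_pos], le_rfl⟩
  have hclosed : IsClosed {y | p (x + π / 2) * sin (y - x) ≤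
      sin (y - (x + π / 2)) * p x + sin (x + π / 2 - x) * p y} :=
    isClosed_le (by fun_prop) (by fun_prop)
  have hlim : p (x + π / 2) * sin (x + π - x) ≤
      sin (x + π - (x + π / 2)) * p x + sin (x + π / 2 - x) * p (x + π) :=
    closure_minimal hev hclosed hmem
  have e₁ : x + π - x = π := by ring
  have e₂ : x + π - (x + π / 2) = π / 2 := by ring
  have e₃ : x + π / 2 - x = π / 2 := by ring
  simpa [e₁, e₂, e₃] using hlim

/-- The left difference quotients at a point are bounded by the right ones, after clearing
denominators. -/
theorem SubSine.mul_sin_add_le {p : ℝ → ℝ} (h : SubSine p) (hcont : Continuous p)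
    (hper : ∀ x : ℝ, p (x + 2 * π) = p x) (θ : ℝ) {s t : ℝ} (hs : s ∈ Set.Ioo 0 π)
    (ht : t ∈ Set.Ioo 0 π) :
    p θ * sin (s + t) ≤ sin t * p (θ - s) + sin s * p (θ + t) := by
  have h3 := (subSine_iff_mul_sin_le p).1 h
  obtain ⟨hs₀, hs₁⟩ := hs
  obtain ⟨ht₀, ht₁⟩ := ht
  rcases lt_trichotomy (s + t) π with hst | hst | hst
  · have := h3 (θ - s) (θ + t) (by linarith) (by linarith) θ ⟨by linarith, by linarith⟩
    have e : θ + t - (θ - s) = s + t := by ring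
    rwa [e, add_sub_cancel_left, sub_sub_cancel] at this
  · have hnn := h.add_pi_nonneg hcont (θ - s)
    obtain rfl : t = π - s := by linarith
    have e : θ - s + π = θ + (π - s) := by ring
    rw [e] at hnn
    rw [hst, sin_pi, sin_pi_sub, ← mul_add, mul_zero]
    exact mul_nonneg (sin_nonneg_of_nonneg_of_le_pi hs₀.le hs₁.le) hnn
  · have hnn := h.add_pi_nonneg hcont θ
    have := h3 (θ + t) (θ - s + 2 * π) (by linarith) (by linarith) (θ + π)
      ⟨by linarith, by linarith⟩
    have e₁ : θ - s + 2 * π - (θ + t) = 2 * π - (s + t) := by ring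
    have e₂ : θ - s + 2 * π - (θ + π) = π - s := by ring
    have e₃ : θ + π - (θ + t) = π - t := by ring
    rw [e₁, e₂, e₃, hper, sin_two_pi_sub, sin_pi_sub, sin_pi_sub] at this
    have hneg : 0 ≤ -sin (s + t) := by
      rw [← sin_two_pi_sub]
      exact sin_nonneg_of_nonneg_of_le_pi (by linarith) (by linarith)
    nlinarith [mul_nonneg hneg hnn]

/-- A continuous periodic sub-sine function has a supporting sinusoid at every point. -/
theorem SubSine.exists_supporting_sinusoid {p : ℝ → ℝ} (h : SubSine p) (hcont : Continuous p)
    (hper : ∀ x : ℝ, p (x + 2 * π) = p x) (θ : ℝ) :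
    ∃ A B : ℝ, A * cos θ + B * sin θ = p θ ∧ ∀ x, A * cos x + B * sin x ≤ p x := by
  let L : ℝ → ℝ := fun s => (p θ * cos s - p (θ - s)) / sin s
  have hLR : ∀ s ∈ Set.Ioo 0 π, ∀ t ∈ Set.Ioo 0 π,
      L s ≤ (p (θ + t) - p θ * cos t) / sin t := by
    intro s hs t ht
    have := h.mul_sin_add_le hcont hper θ hs ht
    rw [sin_add] at this
    rw [div_le_div_iff₀ (sin_pos_of_mem_Ioo hs) (sin_pos_of_mem_Ioo ht)]
    linarith
  have hmid : π / 2 ∈ Set.Ioo 0 π := ⟨by linarith [pi_pos], by linarith [pi_pos]⟩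
  have hbdd : BddAbove (L '' Set.Ioo 0 π) := by
    refine ⟨(p (θ + π / 2) - p θ * cos (π / 2)) / sin (π / 2), ?_⟩
    rintro _ ⟨s, hs, rfl⟩
    exact hLR s hs _ hmid
  obtain ⟨m, hm⟩ : ∃ m, IsLUB (L '' Set.Ioo 0 π) m :=
    ⟨_, isLUB_csSup (Set.Nonempty.image _ ⟨_, hmid⟩) hbdd⟩
  have hright : ∀ t ∈ Set.Ioo 0 π, p θ * cos t + m * sin t ≤ p (θ + t) := by
    intro t ht
    have : m ≤ (p (θ + t) - p θ * cos t) / sin t := hm.2 (by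
      rintro _ ⟨s, hs, rfl⟩
      exact hLR s hs t ht)
    rw [le_div_iff₀ (sin_pos_of_mem_Ioo ht)] at this
    linarith
  have hleft : ∀ s ∈ Set.Ioo 0 π, p θ * cos s - m * sin s ≤ p (θ - s) := by
    intro s hs
    have : L s ≤ m := hm.1 ⟨s, hs, rfl⟩
    rw [div_le_iff₀ (sin_pos_of_mem_Ioo hs)] at this
    linarith
  have key : ∀ x, (p θ * cos θ - m * sin θ) * cos x + (p θ * sin θ + m * cos θ) * sin x =
      p θ * cos (x - θ) + m * sin (x - θ) := by
    intro x
    rw [cos_sub, sin_sub]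
    ring
  refine ⟨p θ * cos θ - m * sin θ, p θ * sin θ + m * cos θ, by simp [key], fun x => ?_⟩
  have hq : Function.Periodic (fun x => p x - (p θ * cos (x - θ) + m * sin (x - θ)))
      (2 * π) := by
    intro x
    have e : x + 2 * π - θ = x - θ + 2 * π := by ring
    simp only [hper, e, cos_add_two_pi, sin_add_two_pi]
  obtain ⟨y, ⟨hy₁, hy₂⟩, hxy⟩ := hq.exists_mem_Ico two_pi_pos x (θ - π)
  rw [key, ← sub_nonneg, hxy, sub_nonneg]
  rcases hy₁.eq_or_lt with rfl | hy₁
  · have := h.add_pi_nonneg hcont (θ - π)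
    have e : θ - π - θ = -π := by ring
    simp only [sub_add_cancel] at this
    simp only [e, cos_neg, cos_pi, sin_neg, sin_pi]
    linarith
  rcases lt_trichotomy y θ with hy | rfl | hy
  · have := hleft (θ - y) ⟨by linarith, by linarith⟩
    rw [sub_sub_cancel] at this
    rw [← neg_sub θ y, cos_neg, sin_neg]
    linarith
  · simp
  · have := hright (y - θ) ⟨by linarith, by linarith⟩
    rwa [add_sub_cancel] at this

theorem isCompact_setOf_forall_le (p : ℝ → ℝ) :
    IsCompact {z : ℝ × ℝ | ∀ θ, z.1 * cos θ + z.2 * sin θ ≤ p θ} := by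
  refine (isCompact_Icc (a := ((-p π, -p (-(π / 2))) : ℝ × ℝ))
    (b := (p 0, p (π / 2)))).of_isClosed_subset ?_ ?_
  · simp only [Set.ofPred_forall]
    exact isClosed_iInter fun θ => isClosed_le (by fun_prop) continuous_const
  · intro z hz
    have h₁ := hz 0
    have h₂ := hz π
    have h₃ := hz (π / 2)
    have h₄ := hz (-(π / 2))
    simp at h₁ h₂ h₃ h₄
    exact ⟨⟨by simp only; linarith, by simp only; linarith⟩, h₁, h₃⟩

theorem convex_setOf_forall_le (p : ℝ → ℝ) :
    Convex ℝ {z : ℝ × ℝ | ∀ θ, z.1 * cos θ + z.2 * sin θ ≤ p θ} := by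
  intro z hz w hw a b ha hb hab θ
  have h₁ := mul_le_mul_of_nonneg_left (hz θ) ha
  have h₂ := mul_le_mul_of_nonneg_left (hw θ) hb
  have e : a * p θ + b * p θ = p θ := by rw [← add_mul, hab, one_mul]
  simp only [Prod.fst_add, Prod.snd_add, Prod.smul_fst, Prod.smul_snd, smul_eq_mul]
  linarith

theorem stmt8 (p : ℝ → ℝ) (hcont : Continuous p)
    (hper : ∀ x : ℝ, p (x + 2 * π) = p x) :
    (∃ K : Set (ℝ × ℝ), K.Nonempty ∧ IsCompact K ∧ Convex ℝ K ∧
        ∀ θ : ℝ, p θ = sSup ((fun z : ℝ × ℝ => z.1 * Real.cos θ + z.2 * Real.sin θ) '' K)) ↔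
      SubSine p := by
  constructor
  · rintro ⟨K, hne, hK, -, hp⟩
    exact subSine_of_eq_sSup hne hK hp
  · intro h
    refine ⟨{z | ∀ θ, z.1 * cos θ + z.2 * sin θ ≤ p θ}, ?_, isCompact_setOf_forall_le p,
      convex_setOf_forall_le p, fun θ => ?_⟩
    · obtain ⟨A, B, -, hAB⟩ := h.exists_supporting_sinusoid hcont hper 0
      exact ⟨(A, B), hAB⟩
    · obtain ⟨A, B, hθ, hAB⟩ := h.exists_supporting_sinusoid hcont hper θ
      symm
      apply IsGreatest.csSup_eq
      refine ⟨⟨(A, B), hAB, hθ⟩, ?_⟩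
      rintro _ ⟨z, hz, rfl⟩
      exact hz θ
end

section
/- Let p : ℝ → ℝ be 2π-periodic and C², set ρ = p + p'', u_θ = (cos θ, sin θ), n_θ = (−sin θ, cos θ), and α(θ) = p(θ) u_θ + p'(θ) n_θ. Then for all θ < θ' < θ + π: α(θ) + R(θ, θ') n_θ = α(θ') − L(θ, θ') n_{θ'}, where R(θ, θ') = (∫_θ^{θ'} sin(θ' − η) ρ(η) dη)/sin(θ' − θ) and L(θ, θ') = (∫_θ^{θ'} sin(η − θ) ρ(η) dη)/sin(θ' − θ). (When p is the support function of a strictly convex body this common point is the intersection of the supporting lines with outward normals u_θ and u_{θ'}, and R, L are the distances from it to the respective tangency points α(θ), α(θ').) -/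
open Real

noncomputable def Rfun (ρ : ℝ → ℝ) (θ θ' : ℝ) : ℝ :=
  (∫ η in θ..θ', Real.sin (θ' - η) * ρ η) / Real.sin (θ' - θ)

noncomputable def Lfun (ρ : ℝ → ℝ) (θ θ' : ℝ) : ℝ :=
  (∫ η in θ..θ', Real.sin (η - θ) * ρ η) / Real.sin (θ' - θ)

/-- Integrating `sin (η - a) * (p + p'') η`, whose primitive is
`p' η * sin (η - a) - p η * cos (η - a)`. -/
theorem integral_sin_sub_mul_add_second_deriv {p p' p'' : ℝ → ℝ}
    (hd1 : ∀ x : ℝ, HasDerivAt p (p' x) x) (hd2 : ∀ x : ℝ, HasDerivAt p' (p'' x) x)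
    (hc : Continuous p'') (a x y : ℝ) :
    ∫ η in x..y, Real.sin (η - a) * (p η + p'' η) =
      (p' y * Real.sin (y - a) - p y * Real.cos (y - a)) -
        (p' x * Real.sin (x - a) - p x * Real.cos (x - a)) := by
  have hp : Continuous p := continuous_iff_continuousAt.2 fun x => (hd1 x).continuousAt
  refine intervalIntegral.integral_eq_sub_of_hasDerivAt
    (f := fun η => p' η * Real.sin (η - a) - p η * Real.cos (η - a)) (fun η _ => ?_)
    (Continuous.intervalIntegrable (by fun_prop) x y)
  have hsub : HasDerivAt (fun η : ℝ => η - a) 1 η := (hasDerivAt_id η).sub_const a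
  exact (((hd2 η).mul hsub.sin).sub ((hd1 η).mul hsub.cos)).congr_deriv (by ring)

theorem stmt9 (p p' p'' : ℝ → ℝ)
    (hper : ∀ x : ℝ, p (x + 2 * π) = p x)
    (hd1 : ∀ x : ℝ, HasDerivAt p (p' x) x)
    (hd2 : ∀ x : ℝ, HasDerivAt p' (p'' x) x)
    (hc : Continuous p'') :
    ∀ θ θ' : ℝ, θ < θ' → θ' < θ + π →
      ((p θ * Real.cos θ - p' θ * Real.sin θ, p θ * Real.sin θ + p' θ * Real.cos θ) : ℝ × ℝ)
          + Rfun (fun t => p t + p'' t) θ θ' • ((-Real.sin θ, Real.cos θ) : ℝ × ℝ)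
        = ((p θ' * Real.cos θ' - p' θ' * Real.sin θ', p θ' * Real.sin θ' + p' θ' * Real.cos θ') : ℝ × ℝ)
          - Lfun (fun t => p t + p'' t) θ θ' • ((-Real.sin θ', Real.cos θ') : ℝ × ℝ) := by
  intro θ θ' hlt hgt
  have hs : Real.sin (θ' - θ) ≠ 0 :=
    (Real.sin_pos_of_pos_of_lt_pi (by linarith) (by linarith)).ne'
  have hR : Rfun (fun t => p t + p'' t) θ θ' =
      (p θ' - p' θ * Real.sin (θ' - θ) - p θ * Real.cos (θ' - θ)) / Real.sin (θ' - θ) := by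
    have hneg : ∀ η, Real.sin (θ' - η) = -Real.sin (η - θ') := fun η => by
      rw [← Real.sin_neg, neg_sub]
    have hcos : Real.cos (θ - θ') = Real.cos (θ' - θ) := by rw [← Real.cos_neg, neg_sub]
    unfold Rfun
    congr 1
    simp only [hneg, neg_mul, intervalIntegral.integral_neg,
      integral_sin_sub_mul_add_second_deriv hd1 hd2 hc, sub_self, Real.sin_zero, Real.cos_zero,
      hcos]
    ring
  have hL : Lfun (fun t => p t + p'' t) θ θ' =
      (p' θ' * Real.sin (θ' - θ) - p θ' * Real.cos (θ' - θ) + p θ) / Real.sin (θ' - θ) := by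
    unfold Lfun
    congr 1
    simp only [integral_sin_sub_mul_add_second_deriv hd1 hd2 hc, sub_self, Real.sin_zero,
      Real.cos_zero]
    ring
  have hsin' := Real.sin_add (θ' - θ) θ
  have hcos' := Real.cos_add (θ' - θ) θ
  have hsin := Real.sin_sub θ' (θ' - θ)
  have hcos := Real.cos_sub θ' (θ' - θ)
  rw [sub_add_cancel] at hsin' hcos'
  rw [sub_sub_cancel] at hsin hcos
  rw [hR, hL]
  generalize Real.sin (θ' - θ) = s at *
  generalize Real.cos (θ' - θ) = c at *
  ext
  · simp only [Prod.fst_add, Prod.fst_sub, Prod.smul_fst, smul_eq_mul]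
    field_simp
    linear_combination -p θ * hsin' - p θ' * hsin
  · simp only [Prod.snd_add, Prod.snd_sub, Prod.smul_snd, smul_eq_mul]
    field_simp
    linear_combination p θ * hcos' + p θ' * hcos
end

section
/- Let ρ : ℝ → ℝ be continuous, 2π-periodic and nonnegative, and for θ < θ' < θ + π define R(θ, θ') = (∫_θ^{θ'} sin(θ' − η) ρ(η) dη)/sin(θ' − θ) and L(θ, θ') = (∫_θ^{θ'} sin(η − θ) ρ(η) dη)/sin(θ' − θ), extended by R(θ, θ) = L(θ, θ) = 0. Then for all x < x' < x + π: (i) (1/2) ∫_x^{x'} L(x, y)² dy = (1/2) ∫_x^{x'} R(y, x')² dy; and, denoting this common value by h(x, x'), (ii) ∂h/∂x (x, x') = −R(x, x')²/2 and ∂h/∂x' (x, x') = L(x, x')²/2. -/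
open Real

open Set Filter Topology

/-- The numerator of `Lfun ρ x y` in terms of primitives `a` of `cos * ρ` and `b` of `sin * ρ`. -/
noncomputable def numL (a b : ℝ → ℝ) (x y : ℝ) : ℝ :=
  Real.cos x * (b y - b x) - Real.sin x * (a y - a x)

/-- The function `∫ η in x..y, numL a b x η * cos (η - x) * ρ η`, written through a primitive `e`
of `a * sin * ρ`. -/
noncomputable def bulk (a b e : ℝ → ℝ) (x y : ℝ) : ℝ :=
  Real.cos x ^ 2 * ((a y - a x) * (b y - b x)) - (e y - e x - a x * (b y - b x))
    + Real.sin x * Real.cos x * ((b y - b x) ^ 2 - (a y - a x) ^ 2) / 2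

/-- Closed form of the generating function of the dual billiards map. -/
noncomputable def potential (a b e : ℝ → ℝ) (x y : ℝ) : ℝ :=
  -(numL a b x y * (numL a b x y / Real.sin (y - x)) * Real.cos (y - x)) / 2 + bulk a b e x y

section

variable {ρ a b e : ℝ → ℝ}

theorem potential_self (x : ℝ) : potential a b e x x = 0 := by
  simp [potential, numL, bulk]

theorem Lfun_eq (hρ : Continuous ρ) (ha : ∀ t, HasDerivAt a (Real.cos t * ρ t) t)
    (hb : ∀ t, HasDerivAt b (Real.sin t * ρ t) t) (x y : ℝ) :
    Lfun ρ x y = numL a b x y / Real.sin (y - x) := by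
  have h : ∫ η in x..y, Real.sin (η - x) * ρ η =
      (Real.cos x * b y - Real.sin x * a y) - (Real.cos x * b x - Real.sin x * a x) := by
    refine intervalIntegral.integral_eq_sub_of_hasDerivAt
      (f := fun η => Real.cos x * b η - Real.sin x * a η) (fun t _ => ?_)
      (Continuous.intervalIntegrable (by fun_prop) _ _)
    refine HasDerivAt.congr_deriv (((hb t).const_mul (Real.cos x)).sub ((ha t).const_mul (Real.sin x))) ?_
    rw [Real.sin_sub]; ring
  rw [Lfun, h, numL]; ring_nf

theorem Rfun_eq (hρ : Continuous ρ) (ha : ∀ t, HasDerivAt a (Real.cos t * ρ t) t)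
    (hb : ∀ t, HasDerivAt b (Real.sin t * ρ t) t) (x y : ℝ) :
    Rfun ρ x y =
      (Real.sin y * (a y - a x) - Real.cos y * (b y - b x)) / Real.sin (y - x) := by
  have h : ∫ η in x..y, Real.sin (y - η) * ρ η =
      (Real.sin y * a y - Real.cos y * b y) - (Real.sin y * a x - Real.cos y * b x) := by
    refine intervalIntegral.integral_eq_sub_of_hasDerivAt
      (f := fun η => Real.sin y * a η - Real.cos y * b η) (fun t _ => ?_)
      (Continuous.intervalIntegrable (by fun_prop) _ _)
    refine HasDerivAt.congr_deriv (((ha t).const_mul (Real.sin y)).sub ((hb t).const_mul (Real.cos y))) ?_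
    rw [Real.sin_sub]; ring
  rw [Rfun, h]; ring_nf

theorem hasDerivAt_numL_right (ha : ∀ t, HasDerivAt a (Real.cos t * ρ t) t)
    (hb : ∀ t, HasDerivAt b (Real.sin t * ρ t) t) (x y : ℝ) :
    HasDerivAt (fun t => numL a b x t) (Real.sin (y - x) * ρ y) y := by
  refine HasDerivAt.congr_deriv ((((hb y).sub_const (b x)).const_mul (Real.cos x)).sub
    (((ha y).sub_const (a x)).const_mul (Real.sin x))) ?_
  rw [Real.sin_sub]; ring

theorem hasDerivAt_numL_left (ha : ∀ t, HasDerivAt a (Real.cos t * ρ t) t)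
    (hb : ∀ t, HasDerivAt b (Real.sin t * ρ t) t) (x y : ℝ) :
    HasDerivAt (fun t => numL a b t y)
      (-(Real.cos x * (a y - a x) + Real.sin x * (b y - b x))) x := by
  refine HasDerivAt.congr_deriv (((Real.hasDerivAt_cos x).mul ((hb x).const_sub (b y))).sub
    ((Real.hasDerivAt_sin x).mul ((ha x).const_sub (a y)))) ?_
  ring

theorem hasDerivAt_bulk_right (ha : ∀ t, HasDerivAt a (Real.cos t * ρ t) t)
    (hb : ∀ t, HasDerivAt b (Real.sin t * ρ t) t)
    (he : ∀ t, HasDerivAt e (a t * (Real.sin t * ρ t)) t) (x y : ℝ) :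
    HasDerivAt (fun t => bulk a b e x t) (numL a b x y * Real.cos (y - x) * ρ y) y := by
  have hA := (ha y).sub_const (a x)
  have hB := (hb y).sub_const (b x)
  refine HasDerivAt.congr_deriv ((((hA.mul hB).const_mul (Real.cos x ^ 2)).sub
    (((he y).sub_const (e x)).sub (hB.const_mul (a x)))).add
    ((((hB.pow 2).sub (hA.pow 2)).const_mul (Real.sin x * Real.cos x)).div_const 2)) ?_
  rw [numL, Real.cos_sub]
  have h := Real.sin_sq_add_cos_sq x
  simp only [Nat.cast_ofNat, Nat.add_one_sub_one, pow_one]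
  linear_combination ((a y - a x) * Real.sin y * ρ y) * h

theorem hasDerivAt_bulk_left (ha : ∀ t, HasDerivAt a (Real.cos t * ρ t) t)
    (hb : ∀ t, HasDerivAt b (Real.sin t * ρ t) t)
    (he : ∀ t, HasDerivAt e (a t * (Real.sin t * ρ t)) t) (x y : ℝ) :
    HasDerivAt (fun t => bulk a b e t y)
      ((numL a b x y ^ 2 - (Real.cos x * (a y - a x) + Real.sin x * (b y - b x)) ^ 2) / 2) x := by
  have hA := (ha x).const_sub (a y)
  have hB := (hb x).const_sub (b y)
  refine HasDerivAt.congr_deriv (((((Real.hasDerivAt_cos x).pow 2).mul (hA.mul hB)).sub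
    (((he x).const_sub (e y)).sub ((ha x).mul hB))).add
    ((((Real.hasDerivAt_sin x).mul (Real.hasDerivAt_cos x)).mul
      ((hB.pow 2).sub (hA.pow 2))).div_const 2)) ?_
  rw [numL]
  have h := Real.sin_sq_add_cos_sq x
  simp only [Nat.cast_ofNat, Nat.add_one_sub_one, pow_one, Pi.mul_apply, Pi.sub_apply, Pi.pow_apply]
  linear_combination (-(Real.cos x * ρ x * (b y - b x))) * h

theorem hasDerivAt_potential_right (ha : ∀ t, HasDerivAt a (Real.cos t * ρ t) t)
    (hb : ∀ t, HasDerivAt b (Real.sin t * ρ t) t)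
    (he : ∀ t, HasDerivAt e (a t * (Real.sin t * ρ t)) t) {x y : ℝ}
    (hs : Real.sin (y - x) ≠ 0) :
    HasDerivAt (fun t => potential a b e x t)
      ((numL a b x y / Real.sin (y - x)) ^ 2 / 2) y := by
  have hN := hasDerivAt_numL_right ha hb x y
  have hd := (hasDerivAt_id y).sub_const x
  refine HasDerivAt.congr_deriv (((((hN.mul (hN.div hd.sin hs)).mul hd.cos).neg).div_const 2).add
    (hasDerivAt_bulk_right ha hb he x y)) ?_
  have h := Real.sin_sq_add_cos_sq (y - x)
  simp only [id, Pi.mul_apply, Pi.div_apply]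
  field_simp
  linear_combination (numL a b x y ^ 2) * h

theorem hasDerivAt_potential_left (ha : ∀ t, HasDerivAt a (Real.cos t * ρ t) t)
    (hb : ∀ t, HasDerivAt b (Real.sin t * ρ t) t)
    (he : ∀ t, HasDerivAt e (a t * (Real.sin t * ρ t)) t) {x y : ℝ}
    (hs : Real.sin (y - x) ≠ 0) :
    HasDerivAt (fun t => potential a b e t y)
      (-((Real.sin y * (a y - a x) - Real.cos y * (b y - b x)) / Real.sin (y - x)) ^ 2 / 2) x := by
  have hN := hasDerivAt_numL_left ha hb x y
  have hd := (hasDerivAt_id x).const_sub y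
  refine HasDerivAt.congr_deriv (((((hN.mul (hN.div hd.sin hs)).mul hd.cos).neg).div_const 2).add
    (hasDerivAt_bulk_left ha hb he x y)) ?_
  have hnum : Real.sin y * (a y - a x) - Real.cos y * (b y - b x) =
      Real.sin (y - x) * (Real.cos x * (a y - a x) + Real.sin x * (b y - b x))
        - Real.cos (y - x) * numL a b x y := by
    have hx := Real.sin_sq_add_cos_sq x
    rw [numL, Real.sin_sub, Real.cos_sub]
    linear_combination (-(Real.sin y * (a y - a x) - Real.cos y * (b y - b x))) * hx
  rw [hnum]
  simp only [id, Pi.mul_apply, Pi.div_apply]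
  generalize numL a b x y = N
  generalize Real.cos x * (a y - a x) + Real.sin x * (b y - b x) = M
  field_simp
  ring

/-- The quotient of two functions vanishing at a point has the limit given by their derivatives;
multiplied by the numerator it is continuous there. -/
theorem continuousAt_mul_div {f g : ℝ → ℝ} {f' g' c : ℝ} (hf : HasDerivAt f f' c)
    (hg : HasDerivAt g g' c) (hfc : f c = 0) (hgc : g c = 0) (hg' : g' ≠ 0) :
    ContinuousAt (fun t => f t * (f t / g t)) c := by
  rw [continuousAt_iff_punctured_nhds]
  have hq : Tendsto (fun t => f t / g t) (𝓝[≠] c) (𝓝 (f' / g')) := by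
    refine ((hasDerivAt_iff_tendsto_slope.1 hf).div
      (hasDerivAt_iff_tendsto_slope.1 hg) hg').congr' ?_
    filter_upwards [self_mem_nhdsWithin] with t ht
    have ht : t - c ≠ 0 := sub_ne_zero.2 ht
    simp only [Pi.div_apply, slope_def_field, hfc, hgc, sub_zero]
    exact div_div_div_cancel_right₀ ht _ _
  have h0 := (hf.continuousAt.tendsto.mono_left (nhdsWithin_le_nhds (s := {c}ᶜ))).mul hq
  simpa [hfc] using h0

theorem continuousAt_potential_right_self (ha : ∀ t, HasDerivAt a (Real.cos t * ρ t) t)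
    (hb : ∀ t, HasDerivAt b (Real.sin t * ρ t) t)
    (he : ∀ t, HasDerivAt e (a t * (Real.sin t * ρ t)) t) (x : ℝ) :
    ContinuousAt (fun t => potential a b e x t) x := by
  have hd := ((hasDerivAt_id x).sub_const x).sin
  have h := continuousAt_mul_div (hasDerivAt_numL_right ha hb x x) hd (by simp [numL])
    (by simp) (by simp)
  exact ((h.mul (by fun_prop : ContinuousAt (fun t => Real.cos (t - x)) x)).neg.div_const 2).add
    (hasDerivAt_bulk_right ha hb he x x).continuousAt

theorem continuousAt_potential_left_self (ha : ∀ t, HasDerivAt a (Real.cos t * ρ t) t)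
    (hb : ∀ t, HasDerivAt b (Real.sin t * ρ t) t)
    (he : ∀ t, HasDerivAt e (a t * (Real.sin t * ρ t)) t) (y : ℝ) :
    ContinuousAt (fun t => potential a b e t y) y := by
  have hd := ((hasDerivAt_id y).const_sub y).sin
  have h := continuousAt_mul_div (hasDerivAt_numL_left ha hb y y) hd (by simp [numL])
    (by simp) (by simp)
  exact ((h.mul (by fun_prop : ContinuousAt (fun t => Real.cos (y - t)) y)).neg.div_const 2).add
    (hasDerivAt_bulk_left ha hb he y y).continuousAt

theorem sin_sub_ne_zero {x y : ℝ} (h : x < y) (h' : y < x + π) : Real.sin (y - x) ≠ 0 :=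
  (Real.sin_pos_of_pos_of_lt_pi (by linarith) (by linarith)).ne'

theorem integral_eq_sub_of_hasDerivAt_of_nonneg {f f' : ℝ → ℝ} {x y : ℝ} (hxy : x ≤ y)
    (hc : ContinuousOn f (Icc x y)) (hd : ∀ t ∈ Ioo x y, HasDerivAt f (f' t) t)
    (hn : ∀ t, 0 ≤ f' t) : ∫ t in x..y, f' t = f y - f x :=
  intervalIntegral.integral_eq_sub_of_hasDerivAt_of_le hxy hc hd
    ((intervalIntegrable_iff_integrableOn_Ioc_of_le hxy).2
      (intervalIntegral.integrableOn_deriv_of_nonneg hc hd fun t _ => hn t))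

theorem half_integral_Lfun_sq (hρ : Continuous ρ) (ha : ∀ t, HasDerivAt a (Real.cos t * ρ t) t)
    (hb : ∀ t, HasDerivAt b (Real.sin t * ρ t) t)
    (he : ∀ t, HasDerivAt e (a t * (Real.sin t * ρ t)) t) {x y : ℝ}
    (h : x < y) (h' : y < x + π) :
    (1 / 2) * ∫ t in x..y, (Lfun ρ x t) ^ 2 = potential a b e x y := by
  have hd : ∀ t ∈ Ioc x y, HasDerivAt (fun t => potential a b e x t) (1 / 2 * Lfun ρ x t ^ 2) t := by
    intro t ht
    refine HasDerivAt.congr_deriv (hasDerivAt_potential_right ha hb he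
      (sin_sub_ne_zero ht.1 (ht.2.trans_lt h'))) ?_
    rw [Lfun_eq hρ ha hb]; ring
  rw [← intervalIntegral.integral_const_mul, integral_eq_sub_of_hasDerivAt_of_nonneg h.le
    (f := fun t => potential a b e x t) _ (fun t ht => hd t ⟨ht.1, ht.2.le⟩)
    (fun t => by positivity), potential_self, sub_zero]
  intro t ht
  rcases ht.1.eq_or_lt with rfl | hlt
  · exact (continuousAt_potential_right_self ha hb he _).continuousWithinAt
  · exact (hd t ⟨hlt, ht.2⟩).continuousAt.continuousWithinAt

theorem half_integral_Rfun_sq (hρ : Continuous ρ) (ha : ∀ t, HasDerivAt a (Real.cos t * ρ t) t)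
    (hb : ∀ t, HasDerivAt b (Real.sin t * ρ t) t)
    (he : ∀ t, HasDerivAt e (a t * (Real.sin t * ρ t)) t) {x y : ℝ}
    (h : x < y) (h' : y < x + π) :
    (1 / 2) * ∫ t in x..y, (Rfun ρ t y) ^ 2 = potential a b e x y := by
  have hd : ∀ t ∈ Ico x y,
      HasDerivAt (fun t => -potential a b e t y) (1 / 2 * Rfun ρ t y ^ 2) t := by
    intro t ht
    refine HasDerivAt.congr_deriv ((hasDerivAt_potential_left ha hb he
      (sin_sub_ne_zero ht.2 (by linarith [ht.1]))).neg) ?_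
    rw [Rfun_eq hρ ha hb]; ring
  rw [← intervalIntegral.integral_const_mul, integral_eq_sub_of_hasDerivAt_of_nonneg h.le
    (f := fun t => -potential a b e t y) _ (fun t ht => hd t ⟨ht.1.le, ht.2⟩)
    (fun t => by positivity), potential_self, neg_zero, zero_sub, neg_neg]
  intro t ht
  rcases ht.2.eq_or_lt with rfl | hlt
  · exact (continuousAt_potential_left_self ha hb he _).neg.continuousWithinAt
  · exact (hd t ⟨ht.1, hlt⟩).continuousAt.continuousWithinAt

end

theorem stmt10 (ρ : ℝ → ℝ)
    (hcont : Continuous ρ)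
    (hper : ∀ x : ℝ, ρ (x + 2 * π) = ρ x)
    (hnonneg : ∀ x : ℝ, 0 ≤ ρ x) :
    ∀ x x' : ℝ, x < x' → x' < x + π →
      ((1 / 2) * ∫ y in x..x', (Lfun ρ x y) ^ 2) = ((1 / 2) * ∫ y in x..x', (Rfun ρ y x') ^ 2) ∧
      HasDerivAt (fun t => (1 / 2) * ∫ y in t..x', (Lfun ρ t y) ^ 2)
        (-(Rfun ρ x x') ^ 2 / 2) x ∧
      HasDerivAt (fun t => (1 / 2) * ∫ y in x..t, (Lfun ρ x y) ^ 2)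
        ((Lfun ρ x x') ^ 2 / 2) x' := by
  intro x x' h h'
  have primitive {f : ℝ → ℝ} (hf : Continuous f) : ∃ F : ℝ → ℝ, ∀ t, HasDerivAt F (f t) t :=
    ⟨fun t => ∫ η in (0 : ℝ)..t, f η, fun t => hf.integral_hasStrictDerivAt 0 t |>.hasDerivAt⟩
  obtain ⟨a, ha⟩ := primitive (Real.continuous_cos.mul hcont)
  obtain ⟨b, hb⟩ := primitive (Real.continuous_sin.mul hcont)
  have ha_cont : Continuous a := continuous_iff_continuousAt.2 fun t => (ha t).continuousAt
  obtain ⟨e, he⟩ := primitive (ha_cont.mul (Real.continuous_sin.mul hcont))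
  have hs := sin_sub_ne_zero h h'
  refine ⟨?_, ?_, ?_⟩
  · rw [half_integral_Lfun_sq hcont ha hb he h h', half_integral_Rfun_sq hcont ha hb he h h']
  · rw [Rfun_eq hcont ha hb]
    refine (hasDerivAt_potential_left ha hb he hs).congr_of_eventuallyEq ?_
    filter_upwards [Iio_mem_nhds h, Ioi_mem_nhds (show x' - π < x by linarith)] with t ht ht'
    exact half_integral_Lfun_sq hcont ha hb he ht (by linarith [mem_Ioi.1 ht'])
  · rw [Lfun_eq hcont ha hb]
    refine (hasDerivAt_potential_right ha hb he hs).congr_of_eventuallyEq ?_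
    filter_upwards [Ioi_mem_nhds h, Iio_mem_nhds h'] with t ht ht'
    exact half_integral_Lfun_sq hcont ha hb he ht ht'
end
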